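/- arXiv:2307.12535 — 2 statements merged into one kernel-verified Lean document; each statement's English description precedes it below -/
import Mathlib

section
/- Let ⟨·⟩ be the Gibbs measure of a system of N spins with Hamiltonian H_N(σ) = β ∑_{1≤i<j≤N} g_{ij} σ_i σ_j + ∑_i h_i σ_i, and for p ≥ 1 and j₁,…,j_p ∈ [N] let m_{j₁…j_p} = ∂_{h_{j₁}}⋯∂_{h_{j_p}} log Z_N(h). Then m_{j₁…j_p} = ⟨ σ¹_{j₁} ∏_{u=1}^{p−1} ( ∑_{v=1}^u (σ^v_{j_{u+1}} − σ^{u+1}_{j_{u+1}}) ) ⟩, where the expectation is with respect to the product Gibbs measure over independent replicas σ¹,…,σ^p. Moreover, for p ≥ 2, ⟨ ∏_{u=1}^{p−1} ( ∑_{v=1}^u (σ^v_{j_{u+1}} − σ^{u+1}_{j_{u+1}}) ) ⟩ = 0. -/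
open MeasureTheory ProbabilityTheory Real Filter

noncomputable section

namespace SK

/-- The spin value `±1` encoded by a Boolean. -/
def spin (b : Bool) : ℝ := if b then 1 else -1

/-- SK Hamiltonian with coupling matrix `g`, inverse temperature `β` and external
field vector `hv`:  `H(σ) = β ∑_{i<j} g_{ij} σ_i σ_j + ∑_i hv_i σ_i`. -/
def hamiltonian (N : ℕ) (β : ℝ) (g : Fin N → Fin N → ℝ) (hv : Fin N → ℝ)
    (σ : Fin N → ℝ) : ℝ :=
  β * ∑ i : Fin N, ∑ j : Fin N, (if i < j then g i j * σ i * σ j else 0)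
    + ∑ i : Fin N, hv i * σ i

/-- Partition function `Z_N`. -/
def partitionZ (N : ℕ) (β : ℝ) (g : Fin N → Fin N → ℝ) (hv : Fin N → ℝ) : ℝ :=
  ∑ s : Fin N → Bool, Real.exp (hamiltonian N β g hv (fun i => spin (s i)))

/-- Gibbs expectation `⟨f⟩`. -/
def gibbs (N : ℕ) (β : ℝ) (g : Fin N → Fin N → ℝ) (hv : Fin N → ℝ)
    (f : (Fin N → ℝ) → ℝ) : ℝ :=
  (∑ s : Fin N → Bool, f (fun i => spin (s i)) *
      Real.exp (hamiltonian N β g hv (fun i => spin (s i)))) / partitionZ N β g hv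

/-- Magnetization `m_i = ⟨σ_i⟩`. -/
def mag (N : ℕ) (β : ℝ) (g : Fin N → Fin N → ℝ) (hv : Fin N → ℝ) (i : Fin N) : ℝ :=
  gibbs N β g hv (fun σ => σ i)

/-- Two point correlation `m_{ij} = ⟨σ_i σ_j⟩ - ⟨σ_i⟩⟨σ_j⟩`. -/
def corr (N : ℕ) (β : ℝ) (g : Fin N → Fin N → ℝ) (hv : Fin N → ℝ) (i j : Fin N) : ℝ :=
  gibbs N β g hv (fun σ => σ i * σ j) - mag N β g hv i * mag N β g hv j

/-- Operator (ℓ²→ℓ²) norm of an `N×N` real matrix. -/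
def opNorm (N : ℕ) (A : Fin N → Fin N → ℝ) : ℝ :=
  sSup {x : ℝ | ∃ u : Fin N → ℝ, (∑ i, u i ^ 2) = 1 ∧
    x = Real.sqrt (∑ i, (∑ j, A i j * u j) ^ 2)}

/-- `q ↦ E tanh²(h + β √q Z)`, `Z` standard Gaussian. -/
def qtanh (β h q : ℝ) : ℝ :=
  ∫ z, Real.tanh (h + β * Real.sqrt q * z) ^ 2 ∂(gaussianReal 0 1)

/-- `q` is the (unique) solution in `(0,1)` of `q = E tanh²(h + β √q Z)`. -/
def isFixedq (β h q : ℝ) : Prop := 0 < q ∧ q < 1 ∧ q = qtanh β h q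

/-- The de Almeida–Thouless condition `β² E sech⁴(h + β √q Z) < 1`. -/
def ATcond (β h q : ℝ) : Prop :=
  β ^ 2 * ∫ z, (Real.cosh (h + β * Real.sqrt q * z))⁻¹ ^ 4 ∂(gaussianReal 0 1) < 1

/-- The functional `Φ(m, q')` from condition (AT+). -/
def Phi (β h q m q' : ℝ) : ℝ :=
  Real.log 2 + β ^ 2 / 4 * (1 - q') ^ 2 - β ^ 2 / 4 * m * (q' ^ 2 - q ^ 2)
    + (1 / m) * ∫ z, Real.log (∫ z', Real.cosh (h + β * Real.sqrt q * z
        + β * Real.sqrt (q' - q) * z') ^ m ∂(gaussianReal 0 1)) ∂(gaussianReal 0 1)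

/-- Condition (AT+): `(∂_m Φ)(m, q')|_{m=1} < 0` for all `q < q' ≤ 1`. -/
def ATplus (β h q : ℝ) : Prop :=
  ∀ q' : ℝ, q < q' → q' ≤ 1 → deriv (fun m => Phi β h q m q') 1 < 0

/-- `G` is a GOE random matrix: symmetric, zero diagonal, and the entries above the
diagonal are i.i.d. centered Gaussians of variance `1/N`. -/
def IsGOE (N : ℕ) {Ω : Type*} [MeasurableSpace Ω] (P : Measure Ω)
    (G : Ω → Fin N → Fin N → ℝ) : Prop :=
  (∀ ω i j, G ω i j = G ω j i) ∧ (∀ ω i, G ω i i = 0) ∧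
  iIndepFun (m := fun _ : {p : Fin N × Fin N // p.1 < p.2} => (inferInstance : MeasurableSpace ℝ))
    (fun p ω => G ω p.1.1 p.1.2) P ∧
  ∀ p : {p : Fin N × Fin N // p.1 < p.2},
    Measure.map (fun ω => G ω p.1.1 p.1.2) P = gaussianReal 0 (N : NNReal)⁻¹


/-- Gibbs expectation over `u` independent replicas. -/
def gibbsRep (N : ℕ) (β : ℝ) (g : Fin N → Fin N → ℝ) (hv : Fin N → ℝ) (u : ℕ)
    (f : (Fin u → Fin N → ℝ) → ℝ) : ℝ :=
  (∑ s : Fin u → Fin N → Bool, f (fun v i => spin (s v i)) *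
      Real.exp (∑ v, hamiltonian N β g hv (fun i => spin (s v i))))
    / (partitionZ N β g hv) ^ u

/-- Partial derivative in the `i`-th field variable. -/
def partialD (N : ℕ) (i : Fin N) (f : (Fin N → ℝ) → ℝ) : (Fin N → ℝ) → ℝ :=
  fun x => deriv (fun t => f (Function.update x i t)) (x i)

/-- Iterated partial derivatives along a list of field indices. -/
def iterPartialD (N : ℕ) : List (Fin N) → ((Fin N → ℝ) → ℝ) → ((Fin N → ℝ) → ℝ)
  | [], f => f
  | i :: l, f => partialD N i (iterPartialD N l f)

/-- `m_{j₁…j_p} = ∂_{h_{j₁}} ⋯ ∂_{h_{j_p}} log Z_N(h)`. -/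
def kPoint (N : ℕ) (β : ℝ) (g : Fin N → Fin N → ℝ) (l : List (Fin N))
    (hv : Fin N → ℝ) : ℝ :=
  iterPartialD N l (fun hv' => Real.log (partitionZ N β g hv')) hv

lemma partitionZ_pos (N : ℕ) (β : ℝ) (g : Fin N → Fin N → ℝ) (x : Fin N → ℝ) :
    0 < partitionZ N β g x :=
  Finset.sum_pos (fun _ _ => Real.exp_pos _) Finset.univ_nonempty

lemma hasDerivAt_hamiltonian (N : ℕ) (β : ℝ) (g : Fin N → Fin N → ℝ) (x : Fin N → ℝ)
    (i : Fin N) (σ : Fin N → ℝ) :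
    HasDerivAt (fun t => hamiltonian N β g (Function.update x i t) σ) (σ i) (x i) := by
  unfold hamiltonian
  apply HasDerivAt.const_add
  have h : ∀ k ∈ (Finset.univ : Finset (Fin N)),
      HasDerivAt (fun t => Function.update x i t k * σ k) (if k = i then σ k else 0) (x i) := by
    intro k _
    by_cases hk : k = i
    · subst hk
      simpa using (hasDerivAt_id (x k)).mul_const (σ k)
    · simpa [hk] using hasDerivAt_const (x i) (x k * σ k)
  have := HasDerivAt.fun_sum h
  simpa using this

/-- Numerator of the replicated Gibbs expectation. -/
def numer (N : ℕ) (β : ℝ) (g : Fin N → Fin N → ℝ) (x : Fin N → ℝ) (n : ℕ)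
    (f : (Fin n → Fin N → ℝ) → ℝ) : ℝ :=
  ∑ s : Fin n → Fin N → Bool, f (fun v i => spin (s v i)) *
      Real.exp (∑ v, hamiltonian N β g x (fun i => spin (s v i)))

lemma hasDerivAt_numer (N : ℕ) (β : ℝ) (g : Fin N → Fin N → ℝ) (x : Fin N → ℝ)
    (i : Fin N) (n : ℕ) (f : (Fin n → Fin N → ℝ) → ℝ) :
    HasDerivAt (fun t => numer N β g (Function.update x i t) n f)
      (numer N β g x n (fun σ => f σ * ∑ v, σ v i)) (x i) := by
  unfold numer
  apply HasDerivAt.fun_sum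
  intro s _
  have h1 : HasDerivAt (fun t => ∑ v, hamiltonian N β g (Function.update x i t)
      (fun i => spin (s v i))) (∑ v, spin (s v i)) (x i) :=
    HasDerivAt.fun_sum fun v _ => hasDerivAt_hamiltonian N β g x i (fun i => spin (s v i))
  have h2 := (h1.exp).const_mul (f (fun v i => spin (s v i)))
  rw [Function.update_eq_self] at h2
  refine h2.congr_deriv ?_
  beta_reduce
  ring

lemma hasDerivAt_partitionZ (N : ℕ) (β : ℝ) (g : Fin N → Fin N → ℝ) (x : Fin N → ℝ)
    (i : Fin N) :
    HasDerivAt (fun t => partitionZ N β g (Function.update x i t))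
      (∑ s : Fin N → Bool, spin (s i) *
        Real.exp (hamiltonian N β g x (fun i => spin (s i)))) (x i) := by
  unfold partitionZ
  apply HasDerivAt.fun_sum
  intro s _
  have h2 := (hasDerivAt_hamiltonian N β g x i (fun i => spin (s i))).exp
  rw [Function.update_eq_self] at h2
  refine h2.congr_deriv ?_
  beta_reduce
  ring

lemma numer_succ (N : ℕ) (β : ℝ) (g : Fin N → Fin N → ℝ) (x : Fin N → ℝ)
    (i : Fin N) (n : ℕ) (f : (Fin n → Fin N → ℝ) → ℝ) :
    numer N β g x (n + 1) (fun σ => f (fun v => σ v.castSucc) *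
        ∑ v : Fin n, (σ v.castSucc i - σ (Fin.last n) i))
      = numer N β g x n (fun σ => f σ * ∑ v, σ v i) * partitionZ N β g x
        - n * numer N β g x n f * (∑ s : Fin N → Bool, spin (s i) *
        Real.exp (hamiltonian N β g x (fun i => spin (s i)))) := by
  unfold numer partitionZ
  rw [← (Fin.snocEquiv (fun _ => Fin N → Bool)).sum_comp, Fintype.sum_prod_type]
  rw [Finset.mul_sum, Finset.mul_sum, ← Finset.sum_sub_distrib]
  apply Finset.sum_congr rfl
  intro a _
  rw [Finset.mul_sum, Finset.sum_mul, Finset.sum_mul, ← Finset.sum_sub_distrib]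
  apply Finset.sum_congr rfl
  intro s _
  simp only [Fin.snocEquiv_apply, Fin.snoc_castSucc, Fin.snoc_last, Fin.sum_univ_castSucc,
    Finset.sum_sub_distrib, Finset.sum_const, Finset.card_univ, Fintype.card_fin, nsmul_eq_mul,
    Real.exp_add]
  ring

lemma hasDerivAt_gibbsRep (N : ℕ) (β : ℝ) (g : Fin N → Fin N → ℝ) (x : Fin N → ℝ)
    (i : Fin N) (n : ℕ) (f : (Fin n → Fin N → ℝ) → ℝ) :
    HasDerivAt (fun t => gibbsRep N β g (Function.update x i t) n f)
      (gibbsRep N β g x (n + 1) (fun σ => f (fun v => σ v.castSucc) *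
        ∑ v : Fin n, (σ v.castSucc i - σ (Fin.last n) i))) (x i) := by
  have hZ := partitionZ_pos N β g x
  have h := (hasDerivAt_numer N β g x i n f).fun_div ((hasDerivAt_partitionZ N β g x i).fun_pow n)
    (by rw [Function.update_eq_self]; positivity)
  simp only [Function.update_eq_self] at h
  have e : gibbsRep N β g x (n + 1) (fun σ => f (fun v => σ v.castSucc) *
        ∑ v : Fin n, (σ v.castSucc i - σ (Fin.last n) i)) =
      numer N β g x (n + 1) (fun σ => f (fun v => σ v.castSucc) *
        ∑ v : Fin n, (σ v.castSucc i - σ (Fin.last n) i)) / partitionZ N β g x ^ (n + 1) := rfl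
  rw [e, numer_succ]
  refine h.congr_deriv ?_
  have hZ' := hZ.ne'
  rcases n with _ | n
  · simp
    field_simp
  · simp only [Nat.add_sub_cancel]
    field_simp
    ring

lemma partialD_gibbsRep (N : ℕ) (β : ℝ) (g : Fin N → Fin N → ℝ) (x : Fin N → ℝ)
    (i : Fin N) (n : ℕ) (f : (Fin n → Fin N → ℝ) → ℝ) :
    partialD N i (fun y => gibbsRep N β g y n f) x
      = gibbsRep N β g x (n + 1) (fun σ => f (fun v => σ v.castSucc) *
        ∑ v : Fin n, (σ v.castSucc i - σ (Fin.last n) i)) :=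
  (hasDerivAt_gibbsRep N β g x i n f).deriv

lemma partialD_log (N : ℕ) (β : ℝ) (g : Fin N → Fin N → ℝ) (x : Fin N → ℝ) (i : Fin N) :
    partialD N i (fun y => Real.log (partitionZ N β g y)) x
      = gibbsRep N β g x 1 (fun σ => σ 0 i) := by
  have hZ := partitionZ_pos N β g x
  have h := (hasDerivAt_partitionZ N β g x i).log
    (by rw [Function.update_eq_self]; exact hZ.ne')
  rw [Function.update_eq_self] at h
  unfold partialD
  rw [h.deriv]
  unfold gibbsRep
  rw [pow_one, ← (Equiv.funUnique (Fin 1) (Fin N → Bool)).symm.sum_comp]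
  simp

lemma partialD_eq_fderiv (N : ℕ) (i : Fin N) (f : (Fin N → ℝ) → ℝ) (hf : Differentiable ℝ f) :
    partialD N i f = fun x => fderiv ℝ f x (Pi.single i 1) := by
  funext x
  have h1 : HasFDerivAt f (fderiv ℝ f x) (Function.update x i (x i)) := by
    rw [Function.update_eq_self]; exact (hf x).hasFDerivAt
  exact (h1.comp_hasDerivAt (x i) (hasDerivAt_update x i (x i))).deriv

lemma contDiff_partialD (N : ℕ) (i : Fin N) (f : (Fin N → ℝ) → ℝ)
    (hf : ContDiff ℝ (⊤ : ℕ∞) f) : ContDiff ℝ (⊤ : ℕ∞) (partialD N i f) := by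
  rw [partialD_eq_fderiv N i f (hf.differentiable (by simp))]
  exact (hf.fderiv_right (m := ((⊤ : ℕ∞) : WithTop ℕ∞)) (by simp)).clm_apply contDiff_const

lemma partialD_comm (N : ℕ) (i k : Fin N) (f : (Fin N → ℝ) → ℝ)
    (hf : ContDiff ℝ (⊤ : ℕ∞) f) :
    partialD N i (partialD N k f) = partialD N k (partialD N i f) := by
  have hd := hf.differentiable (by simp)
  have hd2 : Differentiable ℝ (fderiv ℝ f) :=
    (hf.fderiv_right (m := ((⊤ : ℕ∞) : WithTop ℕ∞)) (by simp)).differentiable (by simp)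
  have key : ∀ a b : Fin N, ∀ x, partialD N a (partialD N b f) x
      = fderiv ℝ (fderiv ℝ f) x (Pi.single a 1) (Pi.single b 1) := by
    intro a b x
    rw [partialD_eq_fderiv N a _ ((contDiff_partialD N b f hf).differentiable (by simp)),
      partialD_eq_fderiv N b f hd]
    simp only
    rw [fderiv_clm_apply (hd2 x) (differentiableAt_const _)]
    simp
  funext x
  rw [key, key]
  exact (hf.contDiffAt.isSymmSndFDerivAt (by
    simp only [minSmoothness_of_isRCLikeNormedField]
    exact WithTop.coe_le_coe.2 (le_top : (2 : ℕ∞) ≤ ⊤))) _ _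

lemma iterPartialD_append (N : ℕ) (l : List (Fin N)) (i : Fin N) :
    ∀ f : (Fin N → ℝ) → ℝ, ContDiff ℝ (⊤ : ℕ∞) f →
    ContDiff ℝ (⊤ : ℕ∞) (iterPartialD N l f) ∧
    iterPartialD N (l ++ [i]) f = partialD N i (iterPartialD N l f) := by
  induction l with
  | nil => intro f hf; exact ⟨hf, rfl⟩
  | cons a l ih =>
    intro f hf
    obtain ⟨h1, h2⟩ := ih f hf
    refine ⟨contDiff_partialD N a _ h1, ?_⟩
    change partialD N a (iterPartialD N (l ++ [i]) f) = partialD N i (partialD N a _)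
    rw [h2, partialD_comm N a i _ h1]

lemma contDiff_log (N : ℕ) (β : ℝ) (g : Fin N → Fin N → ℝ) :
    ContDiff ℝ (⊤ : ℕ∞) (fun y => Real.log (partitionZ N β g y)) := by
  apply ContDiff.log
  · unfold partitionZ hamiltonian
    fun_prop
  · intro x
    exact (partitionZ_pos N β g x).ne'

lemma part_one (N : ℕ) (β : ℝ) (g : Fin N → Fin N → ℝ) (p : ℕ) :
    ∀ (j : Fin (p + 1) → Fin N) (hv : Fin N → ℝ),
    kPoint N β g (List.ofFn j) hv
      = gibbsRep N β g hv (p + 1) (fun σ =>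
          σ 0 (j 0) * ∏ u : Fin p, ∑ v : Fin (u.1 + 1),
            (σ (v.castLE (Nat.succ_le_succ u.2.le)) (j u.succ)
              - σ u.succ (j u.succ))) := by
  induction p with
  | zero =>
    intro j hv
    simpa [kPoint, iterPartialD] using partialD_log N β g hv (j 0)
  | succ p ih =>
    intro j hv
    rw [List.ofFn_succ', List.concat_eq_append]
    unfold kPoint
    rw [(iterPartialD_append N _ _ _ (contDiff_log N β g)).2]
    have h := funext (ih (fun k => j k.castSucc))
    unfold kPoint at h
    have h' : iterPartialD N (List.ofFn fun k : Fin (p + 1) => j k.castSucc)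
      (fun hv' => Real.log (partitionZ N β g hv')) = _ := h
    rw [h', partialD_gibbsRep]
    congr 1
    funext σ
    rw [Fin.prod_univ_castSucc, ← mul_assoc]
    rfl

lemma gibbsRep_one (N : ℕ) (β : ℝ) (g : Fin N → Fin N → ℝ) (x : Fin N → ℝ) :
    gibbsRep N β g x 1 (fun _ => 1) = 1 := by
  have hZ := (partitionZ_pos N β g x).ne'
  unfold gibbsRep
  rw [pow_one, ← (Equiv.funUnique (Fin 1) (Fin N → Bool)).symm.sum_comp,
    div_eq_one_iff_eq hZ]
  simp [partitionZ]

lemma part_two (N : ℕ) (β : ℝ) (g : Fin N → Fin N → ℝ) (p : ℕ) :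
    ∀ (j : Fin (p + 1) → Fin N) (hv : Fin N → ℝ),
    gibbsRep N β g hv (p + 1) (fun σ =>
          ∏ u : Fin p, ∑ v : Fin (u.1 + 1),
            (σ (v.castLE (Nat.succ_le_succ u.2.le)) (j u.succ)
              - σ u.succ (j u.succ)))
      = if p = 0 then 1 else 0 := by
  induction p with
  | zero =>
    intro j hv
    simpa using gibbsRep_one N β g hv
  | succ p ih =>
    intro j hv
    have h := funext (ih (fun k => j k.castSucc))
    have h2 := congrArg (fun F => partialD N (j (Fin.last (p + 1))) F hv) h
    simp only [partialD_gibbsRep] at h2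
    rw [if_neg (Nat.succ_ne_zero p)]
    refine Eq.trans ?_ (h2.trans ?_)
    · congr 1
      funext σ
      rw [Fin.prod_univ_castSucc]
      rfl
    · simp [partialD]

/-- For `p + 1` points `j₁, …, j_{p+1}`, the multi-point correlation
function satisfies the replica representation
`m_{j₁…j_{p+1}} = ⟨σ¹_{j₁} ∏_{u=1}^{p} (∑_{v=1}^u (σ^v_{j_{u+1}} - σ^{u+1}_{j_{u+1}}))⟩`
over `p+1` independent replicas; moreover (for at least two points, i.e. `p ≥ 1`)
`⟨∏_{u=1}^{p} (∑_{v=1}^u (σ^v_{j_{u+1}} - σ^{u+1}_{j_{u+1}}))⟩ = 0`. -/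
theorem replica_representation_of_multi_point_functions
    (N : ℕ) (β : ℝ) (g : Fin N → Fin N → ℝ) (hv : Fin N → ℝ)
    (p : ℕ) (j : Fin (p + 1) → Fin N) :
    (kPoint N β g (List.ofFn j) hv
      = gibbsRep N β g hv (p + 1) (fun σ =>
          σ 0 (j 0) * ∏ u : Fin p, ∑ v : Fin (u.1 + 1),
            (σ ⟨v.1, by have h1 := v.2; have h2 := u.2; omega⟩ (j u.succ)
              - σ ⟨u.1 + 1, by have h2 := u.2; omega⟩ (j u.succ)))) ∧
    (1 ≤ p →
      gibbsRep N β g hv (p + 1) (fun σ =>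
          ∏ u : Fin p, ∑ v : Fin (u.1 + 1),
            (σ ⟨v.1, by have h1 := v.2; have h2 := u.2; omega⟩ (j u.succ)
              - σ ⟨u.1 + 1, by have h2 := u.2; omega⟩ (j u.succ))) = 0) := by
  refine ⟨part_one N β g p j hv, fun hp => ?_⟩
  exact (part_two N β g p j hv).trans (if_neg (Nat.one_le_iff_ne_zero.1 hp))

end SK
end
end

section
/- Let β > 0, h > 0, let q ∈ (0,1) solve q = E tanh²(h + β√q Z), and for q ≤ q' ≤ 1 let F(q') = (∂_m Φ)(m,q')|_{m=1}, where Φ(m,q') = log 2 + (β²/4)(1−q')² − (β²/4) m (q'² − q²) + (1/m) E log E_{Z'} cosh^m(h + β√q Z + β√(q'−q) Z'). Then F(q) = 0, F'(q) = 0, and for q ≤ q' ≤ 1, F''(q') = (β²/2) ( β² E [ E_{Z'} sech³(h + β√q Z + β√(q'−q) Z') / E_{Z'} cosh(h + β√q Z + β√(q'−q) Z') ] − 1 ). -/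
open MeasureTheory ProbabilityTheory Real Filter

noncomputable section

namespace SK

/-- `F(q') = (∂_m Φ)(m, q')|_{m=1}`. -/
def Fq (β h q : ℝ) (q' : ℝ) : ℝ := deriv (fun m => Phi β h q m q') 1

abbrev gs : Measure ℝ := gaussianReal 0 1

/-- at most exponential growth, with continuity -/
def EB (f : ℝ → ℝ) : Prop := Continuous f ∧ ∃ C : ℝ, 0 ≤ C ∧ ∀ x, |f x| ≤ C * exp (2 * |x|)

lemma int_exp_abs (c : ℝ) : Integrable (fun z => exp (c * |z|)) gs := by
  have := integrable_exp_mul_abs (X := id) (μ := gs) (t := c)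
    (by simpa using integrable_exp_mul_gaussianReal c)
    (by simpa using integrable_exp_mul_gaussianReal (-c))
  simpa using this

lemma int_exp_prod (c d : ℝ) :
    Integrable (fun p : ℝ × ℝ => exp (c * |p.1|) * exp (d * |p.2|)) (gs.prod gs) :=
  (int_exp_abs c).mul_prod (int_exp_abs d)

lemma exp_abs_bound (h b β t T k z z' : ℝ) (hk : 0 ≤ k) (ht : |t| ≤ T) :
    exp (k * |h + b * z + β * t * z'|) ≤
      exp (k * |h|) * (exp (k * |b| * |z|) * exp (k * |β| * T * |z'|)) := by
  rw [← exp_add, ← exp_add]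
  apply exp_le_exp.2
  have h1 : |h + b * z + β * t * z'| ≤ |h| + |b| * |z| + |β| * T * |z'| := by
    calc _ ≤ |h| + |b * z| + |β * t * z'| := abs_add_three _ _ _
      _ = |h| + |b| * |z| + |β| * |t| * |z'| := by simp only [abs_mul]
      _ ≤ _ := by gcongr
  nlinarith [mul_le_mul_of_nonneg_left h1 hk]

lemma abs_le_exp_abs (x : ℝ) : |x| ≤ exp |x| := by
  linarith [add_one_le_exp |x|]

lemma one_le_cosh' (x : ℝ) : 1 ≤ cosh x := one_le_cosh x

lemma cosh_le_exp_abs (x : ℝ) : cosh x ≤ exp |x| := by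
  rw [← cosh_abs, cosh_eq]
  have : exp (-|x|) ≤ exp |x| := exp_le_exp.2 (by linarith [abs_nonneg x])
  linarith

lemma inv_cosh_nonneg (x : ℝ) : 0 ≤ (cosh x)⁻¹ := (inv_pos.2 (cosh_pos x)).le
lemma inv_cosh_le_one (x : ℝ) : (cosh x)⁻¹ ≤ 1 := inv_le_one_of_one_le₀ (one_le_cosh x)

lemma log_cosh_nonneg (x : ℝ) : 0 ≤ log (cosh x) := log_nonneg (one_le_cosh x)
lemma log_cosh_le (x : ℝ) : log (cosh x) ≤ |x| := by
  rw [log_le_iff_le_exp (cosh_pos x)]; exact cosh_le_exp_abs x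

/-- integrand -/
def jf (h b β : ℝ) (f : ℝ → ℝ) (t : ℝ) (p : ℝ × ℝ) : ℝ :=
  f (h + b * p.1 + β * t * p.2) * (cosh (h + b * p.1))⁻¹

def J (h b β : ℝ) (f : ℝ → ℝ) (t : ℝ) : ℝ := ∫ p, jf h b β f t p ∂(gs.prod gs)

lemma cont_jf {h b β : ℝ} {f : ℝ → ℝ} (hf : Continuous f) (t : ℝ) : Continuous (jf h b β f t) := by
  unfold jf
  refine Continuous.mul (by fun_prop) (Continuous.inv₀ (by fun_prop) fun p => (cosh_pos _).ne')

lemma jf_bound {f : ℝ → ℝ} {C : ℝ} (hC : 0 ≤ C) (hf : ∀ x, |f x| ≤ C * exp (2 * |x|))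
    (h b β t T : ℝ) (ht : |t| ≤ T) (p : ℝ × ℝ) :
    |jf h b β f t p| ≤ C * exp (2 * |h|) * (exp (2 * |b| * |p.1|) * exp (2 * |β| * T * |p.2|)) := by
  unfold jf
  rw [abs_mul, abs_of_nonneg (inv_cosh_nonneg _)]
  calc _ ≤ |f (h + b * p.1 + β * t * p.2)| * 1 := by gcongr; exact inv_cosh_le_one _
    _ ≤ C * exp (2 * |h + b * p.1 + β * t * p.2|) := by rw [mul_one]; exact hf _
    _ ≤ C * (exp (2 * |h|) * (exp (2 * |b| * |p.1|) * exp (2 * |β| * T * |p.2|))) := by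
        gcongr; exact exp_abs_bound _ _ _ _ _ _ _ _ (by norm_num) ht
    _ = _ := by ring

lemma int_jf {f : ℝ → ℝ} (hf : EB f) (h b β t : ℝ) :
    Integrable (jf h b β f t) (gs.prod gs) := by
  obtain ⟨hc, C, hC, hb⟩ := hf
  refine Integrable.mono' ((int_exp_prod (2 * |b|) (2 * |β| * |t|)).const_mul (C * exp (2 * |h|)))
    (cont_jf hc t).aestronglyMeasurable (ae_of_all _ fun p => ?_)
  exact jf_bound hC hb h b β t |t| le_rfl p

lemma J_cont {f : ℝ → ℝ} (hf : EB f) (h b β : ℝ) : Continuous (J h b β f) := by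
  obtain ⟨hc, C, hC, hb⟩ := hf
  rw [continuous_iff_continuousAt]
  intro t
  refine continuousAt_of_dominated (F := jf h b β f) (bound := fun p => C * exp (2 * |h|) *
    (exp (2 * |b| * |p.1|) * exp (2 * |β| * (|t| + 1) * |p.2|)))
    (Eventually.of_forall fun t => (cont_jf hc t).aestronglyMeasurable) ?_
    ((int_exp_prod _ _).const_mul _) (ae_of_all _ fun p => ?_)
  · filter_upwards [Metric.ball_mem_nhds t one_pos] with s hs
    refine ae_of_all _ fun p => jf_bound hC hb h b β s _ ?_ p
    rw [Metric.mem_ball, Real.dist_eq] at hs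
    linarith [abs_sub_abs_le_abs_sub s t]
  · unfold jf
    refine Continuous.continuousAt ?_
    fun_prop

lemma jf_bound' {f : ℝ → ℝ} {C : ℝ} (hC : 0 ≤ C) (hf : ∀ x, |f x| ≤ C * exp (2 * |x|))
    (h b β t T : ℝ) (ht : |t| ≤ T) (p : ℝ × ℝ) :
    |β * (p.2 * jf h b β f t p)| ≤ |β| * C * exp (2 * |h|) *
      (exp (2 * |b| * |p.1|) * exp ((2 * |β| * T + 1) * |p.2|)) := by
  rw [abs_mul, abs_mul]
  have h1 := jf_bound hC hf h b β t T ht p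
  have h2 := abs_le_exp_abs p.2
  calc |β| * (|p.2| * |jf h b β f t p|) ≤ |β| * (exp |p.2| * (C * exp (2 * |h|) *
        (exp (2 * |b| * |p.1|) * exp (2 * |β| * T * |p.2|)))) := by gcongr
    _ = _ := by rw [add_mul, exp_add, one_mul]; ring

lemma int_jf' {f : ℝ → ℝ} (hf : EB f) (h b β t : ℝ) :
    Integrable (fun p => β * (p.2 * jf h b β f t p)) (gs.prod gs) := by
  obtain ⟨hc, C, hC, hb⟩ := hf
  refine Integrable.mono' ((int_exp_prod (2 * |b|) (2 * |β| * |t| + 1)).const_mul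
    (|β| * C * exp (2 * |h|)))
    (continuous_const.mul (continuous_snd.mul (cont_jf hc t))).aestronglyMeasurable
    (ae_of_all _ fun p => ?_)
  exact jf_bound' hC hb h b β t |t| le_rfl p

lemma J_deriv {f f' : ℝ → ℝ} (hf : EB f) (hf' : EB f') (hd : ∀ x, HasDerivAt f (f' x) x)
    (h b β t : ℝ) :
    HasDerivAt (J h b β f) (∫ p, β * (p.2 * jf h b β f' t p) ∂(gs.prod gs)) t := by
  obtain ⟨hc, C, hC, hb⟩ := hf'
  refine (hasDerivAt_integral_of_dominated_loc_of_deriv_le (F := jf h b β f)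
    (F' := fun t p => β * (p.2 * jf h b β f' t p))
    (bound := fun p => |β| * C * exp (2 * |h|) *
      (exp (2 * |b| * |p.1|) * exp ((2 * |β| * (|t| + 1) + 1) * |p.2|)))
    (Metric.ball_mem_nhds t one_pos)
    (Eventually.of_forall fun t => (cont_jf hf.1 t).aestronglyMeasurable) (int_jf hf h b β t)
    (int_jf' ⟨hc, C, hC, hb⟩ h b β t).aestronglyMeasurable (ae_of_all _ fun p s hs => ?_)
    ((int_exp_prod _ _).const_mul _) (ae_of_all _ fun p s hs => ?_)).2
  · refine jf_bound' hC hb h b β s _ ?_ p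
    rw [Metric.mem_ball, Real.dist_eq] at hs
    linarith [abs_sub_abs_le_abs_sub s t]
  · unfold jf
    have h1 : HasDerivAt (fun s => h + b * p.1 + β * s * p.2) (β * p.2) s := by
      simpa using (((hasDerivAt_id s).const_mul β).mul_const p.2).const_add (h + b * p.1)
    have := ((hd (h + b * p.1 + β * s * p.2)).comp s h1).mul_const (cosh (h + b * p.1))⁻¹
    refine this.congr_deriv ?_
    ring

/-- Gaussian integration by parts -/
lemma gauss_ibp {u u' : ℝ → ℝ} (hd : ∀ x, HasDerivAt u (u' x) x)
    (h0 : Integrable u gs) (h1 : Integrable u' gs) (h2 : Integrable (fun z => z * u z) gs) :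
    ∫ z, z * u z ∂gs = ∫ z, u' z ∂gs := by
  have key : ∀ v : ℝ → ℝ, Integrable v gs → Integrable (fun z => v z * gaussianPDFReal 0 1 z) := by
    intro v hv
    unfold gs at hv
    rw [gaussianReal_of_var_ne_zero 0 one_ne_zero, integrable_withDensity_iff_integrable_smul'
      (measurable_gaussianPDF 0 1) (ae_of_all _ fun _ => gaussianPDF_lt_top)] at hv
    simpa [toReal_gaussianPDF, mul_comm] using hv
  have hp : ∀ x, HasDerivAt (gaussianPDFReal 0 1) (-(x * gaussianPDFReal 0 1 x)) x := by
    intro x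
    unfold gaussianPDFReal
    have : HasDerivAt (fun x : ℝ => -(x - 0) ^ 2 / (2 * ((1 : NNReal) : ℝ))) (-x) x := by
      have := ((hasDerivAt_id x).pow 2).neg.div_const 2
      simp at this ⊢
      exact this.congr_deriv (by ring)
    refine (this.exp.const_mul (√(2 * π * ((1 : NNReal) : ℝ)))⁻¹).congr_deriv ?_
    ring
  have := integral_mul_deriv_eq_deriv_mul_of_integrable (u := u) (u' := u')
    (v := gaussianPDFReal 0 1) (v' := fun x => -(x * gaussianPDFReal 0 1 x))
    (fun x _ => hd x) (fun x _ => hp x) ?_ (key _ h1) (key _ h0)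
  · rw [integral_gaussianReal_eq_integral_smul one_ne_zero,
      integral_gaussianReal_eq_integral_smul one_ne_zero]
    simp only [smul_eq_mul]
    rw [← neg_inj]
    simp only [mul_comm (gaussianPDFReal 0 1 _)]
    rw [← this, ← integral_neg]
    congr 1; ext x; ring
  · refine (key _ h2).neg.congr (ae_of_all _ fun x => ?_)
    simp; ring

lemma ibp_inner {f f' : ℝ → ℝ} (hf : EB f) (hf' : EB f') (hd : ∀ x, HasDerivAt f (f' x) x)
    (a d : ℝ) : ∫ z, z * f (a + d * z) ∂gs = d * ∫ z, f' (a + d * z) ∂gs := by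
  have I : ∀ f, EB f → Integrable (fun z => f (a + d * z)) gs ∧
      Integrable (fun z => z * f (a + d * z)) gs := by
    intro f ⟨hc, C, hC, hb⟩
    have B : ∀ z, |f (a + d * z)| ≤ C * exp (2 * |a|) * exp (2 * |d| * |z|) := by
      intro z
      refine (hb _).trans ?_
      have := exp_abs_bound a 0 d 1 1 2 0 z (by norm_num) (by simp)
      simp at this
      rw [mul_assoc]
      gcongr
    constructor
    · refine Integrable.mono' ((int_exp_abs (2 * |d|)).const_mul (C * exp (2 * |a|)))
        (by fun_prop) (ae_of_all _ B)
    · refine Integrable.mono' ((int_exp_abs (2 * |d| + 1)).const_mul (C * exp (2 * |a|)))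
        (by fun_prop) (ae_of_all _ fun z => ?_)
      rw [norm_mul, Real.norm_eq_abs, Real.norm_eq_abs]
      calc _ ≤ exp |z| * (C * exp (2 * |a|) * exp (2 * |d| * |z|)) := by
            gcongr
            · exact abs_le_exp_abs z
            · exact B z
        _ = _ := by rw [add_mul, exp_add, one_mul]; ring
  rw [← integral_const_mul]
  refine gauss_ibp (fun x => ?_) (I f hf).1 ((I f' hf').1.const_mul d) (I f hf).2
  have h1 : HasDerivAt (fun s => a + d * s) d x := by
    simpa using ((hasDerivAt_id x).const_mul d).const_add a
  have := (hd (a + d * x)).comp x h1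
  rwa [mul_comm] at this

lemma J_deriv2 {f f' f'' : ℝ → ℝ} (hf : EB f) (hf' : EB f') (hf'' : EB f'')
    (hd : ∀ x, HasDerivAt f (f' x) x) (hd' : ∀ x, HasDerivAt f' (f'' x) x)
    (h b β t : ℝ) :
    HasDerivAt (J h b β f) (β ^ 2 * t * J h b β f'' t) t := by
  convert J_deriv hf hf' hd h b β t using 1
  unfold J
  rw [integral_prod _ (int_jf hf'' h b β t), integral_prod _ (int_jf' hf' h b β t),
    ← integral_const_mul]
  congr 1; ext z
  unfold jf
  simp only [integral_mul_const, ← mul_assoc]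
  have := ibp_inner hf' hf'' hd' (h + b * z) (β * t)
  simp only [mul_assoc β, integral_const_mul] at this ⊢
  rw [this]
  ring

/-- heat equation -/
lemma G_deriv {f f' f'' : ℝ → ℝ} (hf : EB f) (hf' : EB f') (hf'' : EB f'')
    (hd : ∀ x, HasDerivAt f (f' x) x) (hd' : ∀ x, HasDerivAt f' (f'' x) x)
    (h b β q y : ℝ) (hy : q ≤ y) :
    HasDerivWithinAt (fun y => J h b β f √(y - q)) (β ^ 2 / 2 * J h b β f'' √(y - q))
      (Set.Ici q) y := by
  have pos : ∀ y, q < y → HasDerivAt (fun y => J h b β f √(y - q))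
      (β ^ 2 / 2 * J h b β f'' √(y - q)) y := by
    intro y hy
    have hs : 0 < √(y - q) := Real.sqrt_pos.2 (by linarith)
    have h1 : HasDerivAt (fun y => √(y - q)) (1 / (2 * √(y - q))) y :=
      ((hasDerivAt_id y).sub_const q).sqrt (by simp; linarith)
    refine ((J_deriv2 hf hf' hf'' hd hd' h b β √(y - q)).comp y h1).congr_deriv ?_
    field_simp
  rcases hy.eq_or_lt with rfl | hy
  · refine hasDerivWithinAt_Ici_of_tendsto_deriv (s := Set.Ioi q) ?_ ?_ self_mem_nhdsWithin ?_
    · intro x hx; exact (pos x hx).differentiableAt.differentiableWithinAt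
    · refine Continuous.continuousWithinAt ?_
      exact (J_cont hf h b β).comp (by fun_prop)
    · have hc : Continuous fun y => β ^ 2 / 2 * J h b β f'' √(y - q) :=
        continuous_const.mul ((J_cont hf'' h b β).comp (by fun_prop))
      refine ((hc.tendsto q).mono_left nhdsWithin_le_nhds).congr' ?_
      filter_upwards [self_mem_nhdsWithin] with x hx
      exact (pos x hx).deriv.symm
  · exact (pos y hy).hasDerivWithinAt


lemma EB.lin {f g : ℝ → ℝ} (hf : EB f) (hg : EB g) (c d : ℝ) :
    EB (fun x => c * f x + d * g x) := by
  obtain ⟨hc, C, hC, hb⟩ := hf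
  obtain ⟨hc', C', hC', hb'⟩ := hg
  refine ⟨by fun_prop, |c| * C + |d| * C', by positivity, fun x => ?_⟩
  calc _ ≤ |c| * |f x| + |d| * |g x| := by
        rw [← abs_mul, ← abs_mul]; exact abs_add_le _ _
    _ ≤ |c| * (C * exp (2 * |x|)) + |d| * (C' * exp (2 * |x|)) := by
        gcongr; exacts [hb x, hb' x]
    _ = _ := by ring

lemma J_lin {f g : ℝ → ℝ} (hf : EB f) (hg : EB g) (c d h b β t : ℝ) :
    J h b β (fun x => c * f x + d * g x) t = c * J h b β f t + d * J h b β g t := by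
  unfold J
  rw [← integral_const_mul, ← integral_const_mul,
    ← integral_add ((int_jf hf h b β t).const_mul c) ((int_jf hg h b β t).const_mul d)]
  congr 1; ext p; unfold jf; ring

lemma one_le_exp_two_abs (x : ℝ) : 1 ≤ exp (2 * |x|) := one_le_exp (by positivity)

lemma exp_abs_le_two (x : ℝ) : exp |x| ≤ exp (2 * |x|) :=
  exp_le_exp.2 (by linarith [abs_nonneg x])

lemma abs_sinh_le (x : ℝ) : |sinh x| ≤ exp |x| := by
  refine le_trans ?_ (cosh_le_exp_abs x)
  rw [abs_sinh, ← cosh_abs]; exact (sinh_lt_cosh _).le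

lemma EB_cosh : EB cosh := ⟨continuous_cosh, 1, by norm_num, fun x => by
  rw [abs_of_pos (cosh_pos x), one_mul]; exact (cosh_le_exp_abs x).trans (exp_abs_le_two x)⟩

lemma cont_logcosh : Continuous fun x => log (cosh x) :=
  continuous_cosh.log fun x => (cosh_pos x).ne'

lemma cont_sech : Continuous fun x => (cosh x)⁻¹ :=
  continuous_cosh.inv₀ fun x => (cosh_pos x).ne'

lemma EB_of_bdd {f : ℝ → ℝ} (hc : Continuous f) (C : ℝ) (hC : 0 ≤ C) (hf : ∀ x, |f x| ≤ C) :
    EB f := ⟨hc, C, hC, fun x => (hf x).trans (by nlinarith [one_le_exp_two_abs x])⟩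

lemma EB_sech : EB fun x => (cosh x)⁻¹ :=
  EB_of_bdd cont_sech 1 zero_le_one fun x => by
    rw [abs_of_nonneg (inv_cosh_nonneg x)]; exact inv_cosh_le_one x

lemma EB_sech3 : EB fun x => (cosh x)⁻¹ ^ 3 :=
  EB_of_bdd (cont_sech.pow 3) 1 zero_le_one fun x => by
    rw [abs_of_nonneg (pow_nonneg (inv_cosh_nonneg x) 3)]
    exact pow_le_one₀ (inv_cosh_nonneg x) (inv_cosh_le_one x)

lemma EB_sech' : EB fun x => -sinh x * ((cosh x)⁻¹ * (cosh x)⁻¹) :=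
  EB_of_bdd (continuous_sinh.neg.mul (cont_sech.mul cont_sech)) 1 zero_le_one fun x => by
    have h1 : |sinh x| ≤ cosh x := by rw [abs_sinh, ← cosh_abs]; exact (sinh_lt_cosh _).le
    have h0 := inv_cosh_nonneg x
    rw [abs_mul, abs_neg, abs_mul, abs_of_nonneg h0]
    calc _ ≤ cosh x * ((cosh x)⁻¹ * 1) := by gcongr; exact inv_cosh_le_one x
      _ = 1 := by rw [mul_one, mul_inv_cancel₀ (cosh_pos x).ne']

lemma EB_g : EB fun x => cosh x * log (cosh x) :=
  ⟨continuous_cosh.mul cont_logcosh, 1, by norm_num, fun x => by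
    rw [abs_mul, abs_of_pos (cosh_pos x), abs_of_nonneg (log_cosh_nonneg x), one_mul, two_mul,
      exp_add]
    gcongr
    · exact log_cosh_nonneg x
    · exact cosh_le_exp_abs x
    · exact (log_cosh_le x).trans (abs_le_exp_abs x)⟩

lemma EB_g' : EB fun x => sinh x * log (cosh x) + sinh x :=
  ⟨(continuous_sinh.mul cont_logcosh).add continuous_sinh, 2, by norm_num, fun x => by
    calc _ ≤ |sinh x| * log (cosh x) + |sinh x| := by
          refine (abs_add_le _ _).trans ?_
          rw [abs_mul, abs_of_nonneg (log_cosh_nonneg x)]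
      _ ≤ exp |x| * exp |x| + exp |x| := by
          gcongr
          · exact log_cosh_nonneg x
          · exact abs_sinh_le x
          · exact (log_cosh_le x).trans (abs_le_exp_abs x)
          · exact abs_sinh_le x
      _ ≤ _ := by
          rw [← exp_add, ← two_mul]; linarith [exp_abs_le_two x]⟩

lemma EB_g'' : EB fun x => 1 * (cosh x * log (cosh x)) + 1 * (2 * cosh x + (-1) * (cosh x)⁻¹) :=
  EB_g.lin (EB_cosh.lin EB_sech 2 (-1)) 1 1

lemma EB_sech'' : EB fun x => 1 * (cosh x)⁻¹ + (-2) * (cosh x)⁻¹ ^ 3 :=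
  EB_sech.lin EB_sech3 1 (-2)

lemma d_logcosh (x : ℝ) : HasDerivAt (fun x => log (cosh x)) (sinh x / cosh x) x :=
  (hasDerivAt_cosh x).log (cosh_pos x).ne'

lemma d_g (x : ℝ) : HasDerivAt (fun x => cosh x * log (cosh x))
    (sinh x * log (cosh x) + sinh x) x := by
  refine ((hasDerivAt_cosh x).mul (d_logcosh x)).congr_deriv ?_
  have := (cosh_pos x).ne'
  field_simp

lemma d_g' (x : ℝ) : HasDerivAt (fun x => sinh x * log (cosh x) + sinh x)
    (1 * (cosh x * log (cosh x)) + 1 * (2 * cosh x + (-1) * (cosh x)⁻¹)) x := by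
  refine (((hasDerivAt_sinh x).mul (d_logcosh x)).add (hasDerivAt_sinh x)).congr_deriv ?_
  have := (cosh_pos x).ne'
  field_simp
  have h2 := cosh_sq x
  linear_combination -h2

lemma d_sech (x : ℝ) : HasDerivAt (fun x => (cosh x)⁻¹)
    (-sinh x * ((cosh x)⁻¹ * (cosh x)⁻¹)) x := by
  refine ((hasDerivAt_cosh x).inv (cosh_pos x).ne').congr_deriv ?_
  have := (cosh_pos x).ne'
  field_simp

lemma d_sech' (x : ℝ) : HasDerivAt (fun x => -sinh x * ((cosh x)⁻¹ * (cosh x)⁻¹))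
    (1 * (cosh x)⁻¹ + (-2) * (cosh x)⁻¹ ^ 3) x := by
  refine ((hasDerivAt_sinh x).neg.mul ((d_sech x).mul (d_sech x))).congr_deriv ?_
  have := (cosh_pos x).ne'
  have h2 := cosh_sq x
  simp only [Pi.mul_apply, Pi.neg_apply]
  field_simp
  linear_combination -2 * h2

lemma int_cosh (a d : ℝ) : ∫ z, cosh (a + d * z) ∂gs = cosh a * exp (d ^ 2 / 2) := by
  have M : ∀ c : ℝ, ∫ z, exp (c * z) ∂gs = exp (c ^ 2 / 2) := by
    intro c
    have := congrFun (mgf_fun_id_gaussianReal (μ := 0) (v := 1)) c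
    simpa [mgf] using this
  have : ∀ z, cosh (a + d * z) = exp a / 2 * exp (d * z) + exp (-a) / 2 * exp (-d * z) := by
    intro z
    rw [cosh_eq, neg_add, exp_add, exp_add, ← neg_mul]; ring
  simp only [this]
  rw [integral_add ((integrable_exp_mul_gaussianReal d).const_mul _)
    ((integrable_exp_mul_gaussianReal (-d)).const_mul _), integral_const_mul, integral_const_mul,
    M, M, cosh_eq, neg_sq]
  ring

lemma ratio_eq {f : ℝ → ℝ} (hf : EB f) (h b β t : ℝ) :
    ∫ z, (∫ z', f (h + b * z + β * t * z') ∂gs) / (∫ z', cosh (h + b * z + β * t * z') ∂gs) ∂gs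
      = exp (-((β * t) ^ 2 / 2)) * J h b β f t := by
  unfold J
  rw [integral_prod _ (int_jf hf h b β t), ← integral_const_mul]
  congr 1; ext z
  rw [int_cosh]
  simp only [jf]
  rw [integral_mul_const, exp_neg]
  have := (cosh_pos (h + b * z)).ne'
  field_simp

lemma J_cosh (h b β t : ℝ) : J h b β cosh t = exp ((β * t) ^ 2 / 2) := by
  unfold J
  rw [integral_prod _ (int_jf EB_cosh h b β t)]
  have : ∀ z, ∫ z', jf h b β cosh t (z, z') ∂gs = exp ((β * t) ^ 2 / 2) := by
    intro z
    simp only [jf]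
    rw [integral_mul_const, int_cosh]
    have := (cosh_pos (h + b * z)).ne'
    field_simp
  simp [this]

/-- m-derivative of the inner integral -/
lemma cosh_rpow_bd (x m : ℝ) (hm : m ≤ 2) : cosh x ^ m ≤ exp (2 * |x|) := by
  calc cosh x ^ m ≤ cosh x ^ (2 : ℝ) := rpow_le_rpow_of_exponent_le (one_le_cosh x) hm
    _ = cosh x * cosh x := by rw [rpow_two, sq]
    _ ≤ exp |x| * exp |x| := by
        gcongr <;> exact cosh_le_exp_abs x
    _ = _ := by rw [← exp_add, two_mul]

lemma cosh_rpow_log_bd (x m : ℝ) (hm : m ≤ 2) :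
    cosh x ^ m * log (cosh x) ≤ exp (3 * |x|) := by
  calc _ ≤ exp (2 * |x|) * exp |x| := by
        gcongr
        · exact log_cosh_nonneg x
        · exact cosh_rpow_bd x m hm
        · exact (log_cosh_le x).trans (abs_le_exp_abs x)
    _ = _ := by rw [← exp_add]; congr 1; ring

lemma aff_bd (a d z : ℝ) : exp (3 * |a + d * z|) ≤ exp (3 * |a|) * exp (3 * |d| * |z|) := by
  have := exp_abs_bound a 0 d 1 1 3 0 z (by norm_num) (by simp)
  simpa using this

lemma cont_rpow (m : ℝ) : Continuous fun x => cosh x ^ m :=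
  continuous_cosh.rpow_const fun x => Or.inl (cosh_pos x).ne'

lemma int_rpow (a d m : ℝ) (hm : m ≤ 2) : Integrable (fun z => cosh (a + d * z) ^ m) gs := by
  refine Integrable.mono' ((int_exp_abs (3 * |d|)).const_mul (exp (3 * |a|)))
    ((cont_rpow m).comp (by fun_prop : Continuous fun z => a + d * z)).aestronglyMeasurable
    (ae_of_all _ fun z => ?_)
  rw [Real.norm_eq_abs, abs_of_pos (rpow_pos_of_pos (cosh_pos _) _)]
  refine (cosh_rpow_bd _ m hm).trans (le_trans ?_ (aff_bd a d z))
  exact exp_le_exp.2 (by linarith [abs_nonneg (a + d * z)])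

lemma int_rpow_log (a d m : ℝ) (hm : m ≤ 2) :
    Integrable (fun z => cosh (a + d * z) ^ m * log (cosh (a + d * z))) gs := by
  refine Integrable.mono' ((int_exp_abs (3 * |d|)).const_mul (exp (3 * |a|)))
    (((cont_rpow m).mul cont_logcosh).comp
      (by fun_prop : Continuous fun z => a + d * z)).aestronglyMeasurable
    (ae_of_all _ fun z => ?_)
  rw [Real.norm_eq_abs, abs_of_nonneg (mul_nonneg (rpow_pos_of_pos (cosh_pos _) _).le
    (log_cosh_nonneg _))]
  exact (cosh_rpow_log_bd _ m hm).trans (aff_bd a d z)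

lemma one_le_int_rpow (a d m : ℝ) (hm0 : 0 ≤ m) (hm : m ≤ 2) :
    1 ≤ ∫ z, cosh (a + d * z) ^ m ∂gs := by
  have := integral_mono (μ := gs) (integrable_const (1 : ℝ)) (int_rpow a d m hm)
    (fun z => one_le_rpow (one_le_cosh _) hm0)
  simpa using this

lemma inner_deriv (a d m : ℝ) (h0 : 0 < m) (hm : m < 2) :
    HasDerivAt (fun m : ℝ => ∫ z, cosh (a + d * z) ^ m ∂gs)
      (∫ z, cosh (a + d * z) ^ m * log (cosh (a + d * z)) ∂gs) m := by
  refine (hasDerivAt_integral_of_dominated_loc_of_deriv_le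
    (F := fun m z => cosh (a + d * z) ^ m)
    (F' := fun m z => cosh (a + d * z) ^ m * log (cosh (a + d * z)))
    (bound := fun z => exp (3 * |a|) * exp (3 * |d| * |z|))
    (Ioo_mem_nhds h0 hm) ?_ (int_rpow a d m hm.le) (int_rpow_log a d m hm.le).aestronglyMeasurable
    (ae_of_all _ fun z s hs => ?_) ((int_exp_abs _).const_mul _)
    (ae_of_all _ fun z s hs => ?_)).2
  · filter_upwards [Ioo_mem_nhds h0 hm] with s hs
    exact (int_rpow a d s hs.2.le).aestronglyMeasurable
  · rw [Real.norm_eq_abs, abs_of_nonneg (mul_nonneg (rpow_pos_of_pos (cosh_pos _) _).le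
      (log_cosh_nonneg _))]
    exact (cosh_rpow_log_bd _ s hs.2.le).trans (aff_bd a d z)
  · have := (hasDerivAt_id s).const_rpow (cosh_pos (a + d * z))
    refine this.congr_deriv ?_
    simp [mul_comm]

lemma meas_inner (h b d : ℝ) {f : ℝ → ℝ} (hf : Continuous f) :
    StronglyMeasurable fun z => ∫ z', f (h + b * z + d * z') ∂gs := by
  have : StronglyMeasurable (fun p : ℝ × ℝ => f (h + b * p.1 + d * p.2)) :=
    (by fun_prop : Continuous fun p : ℝ × ℝ => f (h + b * p.1 + d * p.2)).stronglyMeasurable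
  exact this.integral_prod_right

lemma int_le_const (a d : ℝ) {f : ℝ → ℝ} (hf : ∀ x, f x ≤ exp (3 * |x|))
    (hi : Integrable (fun z => f (a + d * z)) gs) :
    ∫ z, f (a + d * z) ∂gs ≤ exp (3 * |a|) * ∫ z, exp (3 * |d| * |z|) ∂gs := by
  rw [← integral_const_mul]
  exact integral_mono hi ((int_exp_abs _).const_mul _) fun z => (hf _).trans (aff_bd a d z)

lemma outer_deriv (h b d : ℝ) :
    HasDerivAt (fun m : ℝ => ∫ z, log (∫ z', cosh (h + b * z + d * z') ^ m ∂gs) ∂gs)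
      (∫ z, (∫ z', cosh (h + b * z + d * z') ^ (1 : ℝ) * log (cosh (h + b * z + d * z')) ∂gs) /
        (∫ z', cosh (h + b * z + d * z') ^ (1 : ℝ) ∂gs) ∂gs) 1 := by
  set K := ∫ z, exp (3 * |d| * |z|) ∂gs with hK
  have hK0 : 0 ≤ K := integral_nonneg fun z => (exp_pos _).le
  have bd : ∀ z, exp (3 * |h + b * z|) * K ≤ exp (3 * |h|) * K * exp (3 * |b| * |z|) := by
    intro z
    have := aff_bd h b z
    nlinarith
  have hbi : Integrable (fun z => exp (3 * |h|) * K * exp (3 * |b| * |z|)) gs :=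
    (int_exp_abs _).const_mul _
  have hm1 : ∀ m : ℝ, StronglyMeasurable fun z => ∫ z', cosh (h + b * z + d * z') ^ m ∂gs :=
    fun m => meas_inner h b d (cont_rpow m)
  have hm2 : ∀ m : ℝ, StronglyMeasurable fun z =>
      ∫ z', cosh (h + b * z + d * z') ^ m * log (cosh (h + b * z + d * z')) ∂gs :=
    fun m => meas_inner h b d ((cont_rpow m).mul cont_logcosh)
  refine (hasDerivAt_integral_of_dominated_loc_of_deriv_le
    (F := fun m z => log (∫ z', cosh (h + b * z + d * z') ^ m ∂gs))
    (F' := fun m z =>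
      (∫ z', cosh (h + b * z + d * z') ^ m * log (cosh (h + b * z + d * z')) ∂gs) /
        (∫ z', cosh (h + b * z + d * z') ^ m ∂gs))
    (bound := fun z => exp (3 * |h|) * K * exp (3 * |b| * |z|))
    (Ioo_mem_nhds (zero_lt_one' ℝ) one_lt_two)
    (Eventually.of_forall fun m => (hm1 m).measurable.log.aestronglyMeasurable) ?_
    ((hm2 1).measurable.div (hm1 1).measurable).aestronglyMeasurable
    (ae_of_all _ fun z s hs => ?_) hbi (ae_of_all _ fun z s hs => ?_)).2
  · refine Integrable.mono' hbi (hm1 1).measurable.log.aestronglyMeasurable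
      (ae_of_all _ fun z => ?_)
    have h1 := one_le_int_rpow (h + b * z) d 1 zero_le_one one_le_two
    rw [Real.norm_eq_abs, abs_of_nonneg (log_nonneg h1)]
    refine le_trans ?_ (bd z)
    refine le_trans (log_le_self (by linarith)) ?_
    refine int_le_const (h + b * z) d (f := fun x => cosh x ^ (1 : ℝ)) (fun x => ?_)
      (int_rpow _ _ _ one_le_two)
    exact (cosh_rpow_bd x 1 one_le_two).trans (exp_le_exp.2 (by linarith [abs_nonneg x]))
  · have h1 := one_le_int_rpow (h + b * z) d s hs.1.le hs.2.le
    have h2 : 0 ≤ ∫ z', cosh (h + b * z + d * z') ^ s * log (cosh (h + b * z + d * z')) ∂gs :=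
      integral_nonneg fun z' => mul_nonneg (rpow_pos_of_pos (cosh_pos _) _).le (log_cosh_nonneg _)
    rw [Real.norm_eq_abs, abs_of_nonneg (div_nonneg h2 (by linarith))]
    refine le_trans (div_le_self h2 h1) (le_trans ?_ (bd z))
    exact int_le_const (h + b * z) d (f := fun x => cosh x ^ s * log (cosh x))
      (fun x => cosh_rpow_log_bd x s hs.2.le) (int_rpow_log _ _ _ hs.2.le)
  · have h1 := one_le_int_rpow (h + b * z) d s hs.1.le hs.2.le
    exact (inner_deriv (h + b * z) d s hs.1 hs.2).log (by linarith)

lemma int_logcosh (h b : ℝ) : Integrable (fun z => log (cosh (h + b * z))) gs := by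
  refine Integrable.mono' ((int_exp_abs (3 * |b|)).const_mul (exp (3 * |h|)))
    (cont_logcosh.comp (by fun_prop : Continuous fun z => h + b * z)).aestronglyMeasurable
    (ae_of_all _ fun z => ?_)
  rw [Real.norm_eq_abs, abs_of_nonneg (log_cosh_nonneg _)]
  refine le_trans ?_ (aff_bd h b z)
  refine ((log_cosh_le _).trans (abs_le_exp_abs _)).trans ?_
  exact exp_le_exp.2 (by linarith [abs_nonneg (h + b * z)])

/-- closed form of `F` -/
lemma Fq_eq (β h q y : ℝ) (hy : q ≤ y) :
    Fq β h q y = -(β ^ 2 / 4) * (y ^ 2 - q ^ 2)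
      - ((∫ z, log (cosh (h + β * √q * z)) ∂gs) + β ^ 2 / 2 * (y - q))
      + exp (-(β ^ 2 / 2 * (y - q))) *
        J h (β * √q) β (fun x => cosh x * log (cosh x)) √(y - q) := by
  have hd := outer_deriv h (β * √q) (β * √(y - q))
  have hinv : HasDerivAt (fun m : ℝ => 1 / m) (-1) 1 := by
    have := hasDerivAt_inv (one_ne_zero : (1 : ℝ) ≠ 0)
    simpa using this
  have h1 : HasDerivAt (fun m : ℝ => log 2 + β ^ 2 / 4 * (1 - y) ^ 2
      - β ^ 2 / 4 * m * (y ^ 2 - q ^ 2)) (-(β ^ 2 / 4 * 1 * (y ^ 2 - q ^ 2))) 1 :=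
    (((hasDerivAt_id (1 : ℝ)).const_mul (β ^ 2 / 4)).mul_const (y ^ 2 - q ^ 2)).const_sub _
  have hs : (β * √(y - q)) ^ 2 / 2 = β ^ 2 / 2 * (y - q) := by
    rw [mul_pow, Real.sq_sqrt (by linarith)]; ring
  have h2 := (h1.add (hinv.mul hd)).deriv
  have h3 : Fq β h q y = _ := h2
  rw [h3]
  simp only [rpow_one]
  rw [ratio_eq EB_g, hs]
  simp only [int_cosh, hs]
  have h4 : ∀ z, log (cosh (h + β * √q * z) * exp (β ^ 2 / 2 * (y - q)))
      = log (cosh (h + β * √q * z)) + β ^ 2 / 2 * (y - q) := by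
    intro z
    rw [log_mul (cosh_pos _).ne' (exp_pos _).ne', log_exp]
  simp only [h4]
  rw [integral_add (int_logcosh h (β * √q)) (integrable_const _)]
  simp
  ring

lemma J_zero {f : ℝ → ℝ} (hf : EB f) (h b β : ℝ) :
    J h b β f 0 = ∫ z, f (h + b * z) * (cosh (h + b * z))⁻¹ ∂gs := by
  unfold J
  rw [integral_prod _ (int_jf hf h b β 0)]
  simp [jf]

lemma d_exp_aff (c q y : ℝ) :
    HasDerivAt (fun y => exp (-(c * (y - q)))) (-c * exp (-(c * (y - q)))) y := by
  have h1 : HasDerivAt (fun y => -(c * (y - q))) (-(c * 1)) y :=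
    (((hasDerivAt_id y).sub_const q).const_mul c).neg
  refine h1.exp.congr_deriv ?_
  ring

lemma Fq_deriv (β h q y : ℝ) (hy : q ≤ y) :
    HasDerivWithinAt (Fq β h q) (β ^ 2 / 2 * (1 - y - exp (-(β ^ 2 / 2 * (y - q))) *
      J h (β * √q) β (fun x => (cosh x)⁻¹) √(y - q))) (Set.Ici q) y := by
  have hG := G_deriv EB_g EB_g' EB_g'' d_g d_g' h (β * √q) β q y hy
  have hE := (d_exp_aff (β ^ 2 / 2) q y).hasDerivWithinAt (s := Set.Ici q)
  have hP : HasDerivAt (fun y : ℝ => -(β ^ 2 / 4) * (y ^ 2 - q ^ 2)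
      - ((∫ z, log (cosh (h + β * √q * z)) ∂gs) + β ^ 2 / 2 * (y - q)))
      (-(β ^ 2 / 2) * y - β ^ 2 / 2) y := by
    have h1 : HasDerivAt (fun y : ℝ => y ^ 2) (2 * y) y := by simpa using hasDerivAt_pow 2 y
    refine (((h1.sub_const (q ^ 2)).const_mul (-(β ^ 2 / 4))).sub
      ((((hasDerivAt_id y).sub_const q).const_mul (β ^ 2 / 2)).const_add _)).congr_deriv ?_
    ring
  have hT := hP.hasDerivWithinAt.add (hE.mul hG)
  refine (hT.congr (fun x hx => Fq_eq β h q x hx) (Fq_eq β h q y hy)).congr_deriv ?_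
  rw [J_lin EB_g (EB_cosh.lin EB_sech 2 (-1)), J_lin EB_cosh EB_sech, J_cosh]
  have hs : (β * √(y - q)) ^ 2 / 2 = β ^ 2 / 2 * (y - q) := by
    rw [mul_pow, Real.sq_sqrt (by linarith)]; ring
  rw [hs, exp_neg]
  have := (exp_pos (β ^ 2 / 2 * (y - q))).ne'
  field_simp
  ring

lemma Fq_deriv2 (β h q y : ℝ) (hy : q ≤ y) :
    HasDerivWithinAt (fun y => β ^ 2 / 2 * (1 - y - exp (-(β ^ 2 / 2 * (y - q))) *
      J h (β * √q) β (fun x => (cosh x)⁻¹) √(y - q)))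
      (β ^ 2 / 2 * (β ^ 2 * (exp (-(β ^ 2 / 2 * (y - q))) *
      J h (β * √q) β (fun x => (cosh x)⁻¹ ^ 3) √(y - q)) - 1)) (Set.Ici q) y := by
  have hG := G_deriv EB_sech EB_sech' EB_sech'' d_sech d_sech' h (β * √q) β q y hy
  have hE := (d_exp_aff (β ^ 2 / 2) q y).hasDerivWithinAt (s := Set.Ici q)
  have hT := ((((hasDerivAt_id y).const_sub 1).hasDerivWithinAt.sub (hE.mul hG)).const_mul
    (β ^ 2 / 2))
  refine hT.congr_deriv ?_
  rw [J_lin EB_sech EB_sech3]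
  ring

/-- With `F(q') = (∂_m Φ)(m,q')|_{m=1}` on `[q,1]`: `F(q) = 0`,
`F'(q) = 0`, and for all `q' ∈ [q,1]`,
`F''(q') = (β²/2)(β² E[E_{Z'} sech³(h+β√q Z+β√(q'-q) Z') / E_{Z'} cosh(h+β√q Z+β√(q'-q) Z')] - 1)`,
the derivatives in `q'` being taken within `[q,1]`. -/
theorem derivatives_of_ATplus_functional
    (β h q : ℝ) (hβ : 0 < β) (hh : 0 < h) (hq : isFixedq β h q) :
    Fq β h q q = 0 ∧
    derivWithin (Fq β h q) (Set.Icc q 1) q = 0 ∧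
    ∀ q' ∈ Set.Icc q 1,
      derivWithin (fun y => derivWithin (Fq β h q) (Set.Icc q 1) y) (Set.Icc q 1) q'
        = β ^ 2 / 2 *
          (β ^ 2 * (∫ z,
              (∫ z', (Real.cosh (h + β * Real.sqrt q * z
                  + β * Real.sqrt (q' - q) * z'))⁻¹ ^ 3 ∂(gaussianReal 0 1))
                / (∫ z', Real.cosh (h + β * Real.sqrt q * z
                  + β * Real.sqrt (q' - q) * z') ∂(gaussianReal 0 1))
              ∂(gaussianReal 0 1)) - 1) := by
  obtain ⟨hq0, hq1, hfix⟩ := hq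
  have hU : ∀ y ∈ Set.Icc q 1, UniqueDiffWithinAt ℝ (Set.Icc q 1) y :=
    uniqueDiffOn_Icc hq1
  have D1 : ∀ y ∈ Set.Icc q 1, derivWithin (Fq β h q) (Set.Icc q 1) y =
      β ^ 2 / 2 * (1 - y - exp (-(β ^ 2 / 2 * (y - q))) *
      J h (β * √q) β (fun x => (cosh x)⁻¹) √(y - q)) := fun y hy =>
    ((Fq_deriv β h q y hy.1).mono Set.Icc_subset_Ici_self).derivWithin (hU y hy)
  refine ⟨?_, ?_, ?_⟩
  · rw [Fq_eq β h q q le_rfl, sub_self, sub_self, Real.sqrt_zero, J_zero EB_g]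
    have : ∀ x : ℝ, cosh x * log (cosh x) * (cosh x)⁻¹ = log (cosh x) := by
      intro x
      have := (cosh_pos x).ne'
      field_simp
    simp [this]
  · rw [D1 q ⟨le_rfl, hq1.le⟩, sub_self, Real.sqrt_zero, J_zero EB_sech]
    have e : ∀ x : ℝ, tanh x ^ 2 = 1 - (cosh x)⁻¹ * (cosh x)⁻¹ := by
      intro x
      have := (cosh_pos x).ne'
      rw [tanh_eq_sinh_div_cosh]
      field_simp
      linear_combination -cosh_sq x
    unfold qtanh at hfix
    simp only [e] at hfix
    have hi : Integrable (fun z => (cosh (h + β * √q * z))⁻¹ * (cosh (h + β * √q * z))⁻¹) gs := by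
      refine Integrable.mono' (integrable_const (1 : ℝ)) ((cont_sech.mul cont_sech).comp
        (by fun_prop : Continuous fun z => h + β * √q * z)).aestronglyMeasurable
        (ae_of_all _ fun z => ?_)
      rw [Real.norm_eq_abs, abs_of_nonneg (mul_nonneg (inv_cosh_nonneg _) (inv_cosh_nonneg _))]
      exact mul_le_one₀ (inv_cosh_le_one _) (inv_cosh_nonneg _) (inv_cosh_le_one _)
    rw [integral_sub (integrable_const _) hi] at hfix
    simp only [integral_const, probReal_univ, smul_eq_mul, mul_one] at hfix
    simp only [mul_zero, neg_zero, exp_zero, one_mul]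
    rw [mul_eq_zero]; right
    linarith
  · intro y hy
    rw [derivWithin_congr (fun x hx => D1 x hx) (D1 y hy),
      ((Fq_deriv2 β h q y hy.1).mono Set.Icc_subset_Ici_self).derivWithin (hU y hy)]
    have := ratio_eq EB_sech3 h (β * √q) β √(y - q)
    rw [this, mul_pow, Real.sq_sqrt (by linarith [hy.1])]
    congr 6
    ring

end SK
end
end
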